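/- Let n ≥ 7 and set L₃(y) := (|y|² - 1)/[(1+yₙ)² + |ȳ|²]^{n-1} for y = (ȳ, yₙ) ∈ ℝⁿ₊. Then ∫_{ℝⁿ₊} L₃(y)·yₙ² dy = ω_{n-2}·32/((n-3)(n-4)(n-5)(n-6))·Iₙⁿ. -/

import Mathlib

open MeasureTheory

noncomputable section

/-- The index of the last coordinate in `Fin n`. -/
def lastIdx (n : ℕ) [NeZero n] : Fin n :=
  ⟨n - 1, Nat.sub_lt (Nat.pos_of_ne_zero (NeZero.ne n)) Nat.one_pos⟩

/-- The last coordinate `yₙ` of a point `y ∈ ℝⁿ`. -/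
def lastCoord (n : ℕ) [NeZero n] (y : EuclideanSpace ℝ (Fin n)) : ℝ :=
  y (lastIdx n)

/-- `|ȳ|²`, the squared norm of the first `n-1` coordinates. -/
def barNormSq (n : ℕ) [NeZero n] (y : EuclideanSpace ℝ (Fin n)) : ℝ :=
  ∑ i : Fin n, if (i : ℕ) < n - 1 then (y i) ^ 2 else 0

/-- The closed upper half-space `ℝⁿ₊ = {y : yₙ ≥ 0}`. -/
def halfSpace (n : ℕ) [NeZero n] : Set (EuclideanSpace ℝ (Fin n)) :=
  {y | 0 ≤ lastCoord n y}

/-- The surface measure of the unit sphere `S^{d-1} ⊂ ℝ^d`, expressed as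
`d · vol(B₁^d)`. For `d = n-1` this is `ω_{n-2}`, the area of `S^{n-2} ⊂ ℝ^{n-1}`. -/
def sphereArea (d : ℕ) : ℝ :=
  (d : ℝ) * (volume (Metric.ball (0 : EuclideanSpace ℝ (Fin d)) 1)).toReal

/-- `I_m^α := ∫₀^∞ s^α/(1+s²)^m ds`; in particular `Iint n n = Iₙⁿ`. -/
def Iint (m α : ℕ) : ℝ := ∫ s in Set.Ioi (0 : ℝ), s ^ α / (1 + s ^ 2) ^ m

/-- `L₁(y) = (|y|²-1)/((1+yₙ)²+|ȳ|²)^{n+1}`. -/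
def L1 (n : ℕ) [NeZero n] (y : EuclideanSpace ℝ (Fin n)) : ℝ :=
  (‖y‖ ^ 2 - 1) / ((1 + lastCoord n y) ^ 2 + barNormSq n y) ^ (n + 1)

/-- `L₂(y) = (|y|²-1)/((1+yₙ)²+|ȳ|²)^{n}`. -/
def L2 (n : ℕ) [NeZero n] (y : EuclideanSpace ℝ (Fin n)) : ℝ :=
  (‖y‖ ^ 2 - 1) / ((1 + lastCoord n y) ^ 2 + barNormSq n y) ^ n

/-- `L₃(y) = (|y|²-1)/((1+yₙ)²+|ȳ|²)^{n-1}`. -/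
def L3 (n : ℕ) [NeZero n] (y : EuclideanSpace ℝ (Fin n)) : ℝ :=
  (‖y‖ ^ 2 - 1) / ((1 + lastCoord n y) ^ 2 + barNormSq n y) ^ (n - 1)

lemma aux_pow_le (α m : ℕ) (h : α ≤ 2 * m) (s : ℝ) (hs : 0 ≤ s) : s ^ α ≤ (1 + s ^ 2) ^ m := by
  rcases le_total s 1 with h1 | h1
  · calc s ^ α ≤ 1 := pow_le_one₀ hs h1
      _ ≤ (1 + s ^ 2) ^ m := one_le_pow₀ (by nlinarith [sq_nonneg s])
  · calc s ^ α ≤ s ^ (2 * m) := pow_le_pow_right₀ h1 h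
      _ = (s ^ 2) ^ m := by rw [pow_mul]
      _ ≤ (1 + s ^ 2) ^ m := by gcongr; linarith

lemma aux_integrable (α m : ℕ) (h : α + 2 ≤ 2 * m) :
    IntegrableOn (fun s : ℝ => s ^ α / (1 + s ^ 2) ^ m) (Set.Ioi 0) := by
  have hp : ∀ s : ℝ, 0 < 1 + s ^ 2 := fun s => by positivity
  refine Integrable.mono' (integrable_inv_one_add_sq.integrableOn (s := Set.Ioi 0)) ?_ ?_
  · apply Continuous.aestronglyMeasurable
    exact Continuous.div (by fun_prop) (by fun_prop) (fun s => by positivity)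
  · refine (ae_restrict_iff' measurableSet_Ioi).2 (Filter.Eventually.of_forall fun s hs => ?_)
    have hs0 : (0 : ℝ) ≤ s := le_of_lt hs
    obtain ⟨k, rfl⟩ : ∃ k, m = k + 1 := ⟨m - 1, by omega⟩
    rw [Real.norm_of_nonneg (by positivity), inv_eq_one_div, div_le_div_iff₀ (by positivity) (hp s),
      pow_succ, one_mul]
    exact mul_le_mul_of_nonneg_right (aux_pow_le α k (by omega) s hs0) (hp s).le

lemma aux_tendsto (α m : ℕ) (h : α + 1 ≤ 2 * m) :
    Filter.Tendsto (fun s : ℝ => s ^ α / (1 + s ^ 2) ^ m) Filter.atTop (nhds 0) := by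
  refine squeeze_zero' ?_ ?_ (tendsto_inv_atTop_zero (𝕜 := ℝ))
  · filter_upwards [Filter.eventually_ge_atTop 0] with s hs
    positivity
  · filter_upwards [Filter.eventually_gt_atTop 0] with s hs
    rw [inv_eq_one_div, div_le_div_iff₀ (by positivity) hs, one_mul, ← pow_succ]
    exact aux_pow_le _ m h s hs.le

lemma aux_deriv (p q : ℕ) (s : ℝ) :
    HasDerivAt (fun s : ℝ => s ^ (p + 1) / (1 + s ^ 2) ^ (q + 1))
      ((p + 1) * (s ^ p / (1 + s ^ 2) ^ (q + 1))
        - 2 * (q + 1) * (s ^ (p + 2) / (1 + s ^ 2) ^ (q + 2))) s := by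
  have hp : 0 < 1 + s ^ 2 := by positivity
  have h1 : HasDerivAt (fun s : ℝ => s ^ (p + 1)) ((p + 1) * s ^ p) s := by
    simpa using hasDerivAt_pow (p + 1) s
  have h2 : HasDerivAt (fun s : ℝ => (1 + s ^ 2)) (2 * s) s := by
    simpa using (hasDerivAt_pow 2 s).const_add 1
  have h3 := h1.div (h2.pow (q + 1)) (pow_pos hp _).ne'
  refine h3.congr_deriv ?_
  simp only [Nat.add_sub_cancel, Pi.pow_apply]
  push_cast
  field_simp
  ring

lemma aux_rec (p q : ℕ) (h : p + 2 ≤ 2 * (q + 1)) :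
    ((p : ℝ) + 1) * ∫ s in Set.Ioi (0 : ℝ), s ^ p / (1 + s ^ 2) ^ (q + 1)
      = 2 * ((q : ℝ) + 1) * ∫ s in Set.Ioi (0 : ℝ), s ^ (p + 2) / (1 + s ^ 2) ^ (q + 2) := by
  have i1 := (aux_integrable p (q + 1) h).const_mul ((p : ℝ) + 1)
  have i2 := (aux_integrable (p + 2) (q + 2) (by omega)).const_mul (2 * ((q : ℝ) + 1))
  have := integral_Ioi_of_hasDerivAt_of_tendsto' (a := (0 : ℝ)) (fun s _ => aux_deriv p q s)
    (i1.sub i2) (aux_tendsto (p + 1) (q + 1) (by omega))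
  rw [integral_sub i1 i2, integral_const_mul, integral_const_mul] at this
  simp at this
  linarith

lemma aux_split (p q : ℕ) (h : p + 2 ≤ 2 * q) :
    ∫ s in Set.Ioi (0 : ℝ), s ^ (p + 2) / (1 + s ^ 2) ^ (q + 1)
      = (∫ s in Set.Ioi (0 : ℝ), s ^ p / (1 + s ^ 2) ^ q)
        - ∫ s in Set.Ioi (0 : ℝ), s ^ p / (1 + s ^ 2) ^ (q + 1) := by
  rw [← integral_sub (aux_integrable p q h) (aux_integrable p (q + 1) (by omega))]
  congr 1
  ext s
  have hp : 0 < 1 + s ^ 2 := by positivity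
  field_simp
  ring

lemma aux_inv (p : ℕ) :
    IntegrableOn (fun t : ℝ => 1 / (1 + t) ^ (p + 2)) (Set.Ioi 0) ∧
      ∫ t in Set.Ioi (0 : ℝ), 1 / (1 + t) ^ (p + 2) = 1 / ((p : ℝ) + 1) := by
  have hd : ∀ t ∈ Set.Ici (0 : ℝ), HasDerivAt
      (fun t : ℝ => -(1 / ((p : ℝ) + 1)) * ((1 + t) ^ (p + 1))⁻¹) (1 / (1 + t) ^ (p + 2)) t := by
    intro t ht
    have ht' : (0 : ℝ) < 1 + t := by have : (0 : ℝ) ≤ t := ht; linarith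
    have h1 : HasDerivAt (fun t : ℝ => 1 + t) 1 t := (hasDerivAt_id t).const_add 1
    have h2 := ((h1.pow (p + 1)).inv (by simp; positivity)).const_mul (-(1 / ((p : ℝ) + 1)))
    refine h2.congr_deriv ?_
    simp only [Nat.add_sub_cancel, Pi.pow_apply]
    push_cast
    field_simp
    ring
  have ht : Filter.Tendsto (fun t : ℝ => -(1 / ((p : ℝ) + 1)) * ((1 + t) ^ (p + 1))⁻¹)
      Filter.atTop (nhds 0) := by
    have h1 : Filter.Tendsto (fun t : ℝ => (1 + t) ^ (p + 1)) Filter.atTop Filter.atTop :=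
      (Filter.tendsto_pow_atTop (by omega)).comp (Filter.tendsto_atTop_add_const_left _ 1 Filter.tendsto_id)
    simpa using h1.inv_tendsto_atTop.const_mul (-(1 / ((p : ℝ) + 1)))
  have hpos : ∀ t ∈ Set.Ioi (0 : ℝ), 0 ≤ 1 / (1 + t) ^ (p + 2) := by
    intro t ht
    have : (0 : ℝ) < t := ht
    positivity
  refine ⟨integrableOn_Ioi_deriv_of_nonneg' hd hpos ht, ?_⟩
  rw [integral_Ioi_of_hasDerivAt_of_nonneg' hd hpos ht]
  simp

lemma aux_t (e : ℕ) :
    IntegrableOn (fun t : ℝ => t ^ 2 / (1 + t) ^ (e + 4)) (Set.Ioi 0) ∧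
      ∫ t in Set.Ioi (0 : ℝ), t ^ 2 / (1 + t) ^ (e + 4)
        = 2 / (((e : ℝ) + 1) * (e + 2) * (e + 3)) := by
  obtain ⟨i0, v0⟩ := aux_inv e
  obtain ⟨i1, v1⟩ := aux_inv (e + 1)
  obtain ⟨i2, v2⟩ := aux_inv (e + 2)
  have heq : Set.EqOn (fun t : ℝ => 1 / (1 + t) ^ (e + 2) - 2 * (1 / (1 + t) ^ (e + 1 + 2))
      + 1 / (1 + t) ^ (e + 2 + 2)) (fun t : ℝ => t ^ 2 / (1 + t) ^ (e + 4)) (Set.Ioi 0) := by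
    intro t ht
    have ht' : (0 : ℝ) < 1 + t := by have : (0 : ℝ) < t := ht; linarith
    simp only
    field_simp
    ring
  have i3 := (i0.sub (i1.const_mul 2)).add i2
  refine ⟨i3.congr_fun heq measurableSet_Ioi, ?_⟩
  rw [← setIntegral_congr_fun measurableSet_Ioi heq,
    integral_add (f := fun t : ℝ => 1 / (1 + t) ^ (e + 2) - 2 * (1 / (1 + t) ^ (e + 1 + 2)))
      (i0.sub (i1.const_mul 2)) i2, integral_sub i0 (i1.const_mul 2),
    integral_const_mul, v0, v1, v2]
  push_cast
  field_simp
  ring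

lemma aux_slice (d m q : ℕ) (hq : q + 1 + (d + 1) = 2 * m) (a : ℝ) (ha : 0 < a) :
    Integrable (fun x : EuclideanSpace ℝ (Fin (d + 1)) => 1 / (a ^ 2 + ‖x‖ ^ 2) ^ m) ∧
      ∫ x : EuclideanSpace ℝ (Fin (d + 1)), 1 / (a ^ 2 + ‖x‖ ^ 2) ^ m
        = sphereArea (d + 1) * Iint m d * (1 / a ^ (q + 1)) := by
  set g : ℝ → ℝ := fun y => y ^ d * (1 / (a ^ 2 + y ^ 2) ^ m) with hg
  have hscale : ∀ s : ℝ, g (a * s) = (1 / a ^ (q + 2)) * (s ^ d / (1 + s ^ 2) ^ m) := by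
    intro s
    have hp : 0 < 1 + s ^ 2 := by positivity
    have h1 : a ^ 2 + (a * s) ^ 2 = a ^ 2 * (1 + s ^ 2) := by ring
    have h2 : (a ^ 2) ^ m = a ^ (q + 2) * a ^ d := by
      rw [← pow_mul, ← pow_add]; congr 1; omega
    simp only [hg]
    rw [h1, mul_pow, mul_pow, h2]
    field_simp
  have hint : IntegrableOn g (Set.Ioi 0) := by
    have := (integrableOn_Ioi_comp_mul_left_iff g 0 ha).1 (by
      simp only [hscale]
      exact (aux_integrable d m (by omega)).const_mul _)
    simpa using this
  have hval : ∫ y in Set.Ioi (0 : ℝ), g y = Iint m d * (1 / a ^ (q + 1)) := by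
    have := integral_comp_mul_left_Ioi' g 0 ha
    rw [mul_zero] at this
    rw [← this]
    simp only [hscale]
    rw [integral_const_mul, Iint, smul_eq_mul]
    field_simp
    ring
  constructor
  · rw [integrable_fun_norm_addHaar volume (f := fun y : ℝ => 1 / (a ^ 2 + y ^ 2) ^ m)]
    simpa [hg] using hint
  · rw [integral_fun_norm_addHaar volume (fun y : ℝ => 1 / (a ^ 2 + y ^ 2) ^ m)]
    simp only [finrank_euclideanSpace, Fintype.card_fin, Nat.add_sub_cancel, smul_eq_mul,
      nsmul_eq_mul]
    rw [show (∫ y in Set.Ioi (0 : ℝ), y ^ d * (1 / (a ^ 2 + y ^ 2) ^ m)) = _ from hval]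
    simp only [sphereArea, Measure.real]
    ring

lemma aux_prod (d m q : ℕ) (hq : q + 1 + (d + 1) = 2 * m) (g : ℝ → ℝ) (hgc : Continuous g)
    (hg0 : ∀ t, 0 < t → 0 ≤ g t)
    (hgi : IntegrableOn (fun t : ℝ => g t * (1 / (1 + t) ^ (q + 1))) (Set.Ioi 0)) :
    Integrable (fun p : ℝ × EuclideanSpace ℝ (Fin (d + 1)) =>
        g p.1 * (1 / ((1 + p.1) ^ 2 + ‖p.2‖ ^ 2) ^ m))
        ((volume.restrict (Set.Ioi 0)).prod volume) ∧
      ∫ p : ℝ × EuclideanSpace ℝ (Fin (d + 1)),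
        g p.1 * (1 / ((1 + p.1) ^ 2 + ‖p.2‖ ^ 2) ^ m)
        ∂((volume.restrict (Set.Ioi 0)).prod volume)
        = sphereArea (d + 1) * Iint m d *
          ∫ t in Set.Ioi (0 : ℝ), g t * (1 / (1 + t) ^ (q + 1)) := by
  have hI : Integrable (fun p : ℝ × EuclideanSpace ℝ (Fin (d + 1)) =>
        g p.1 * (1 / ((1 + p.1) ^ 2 + ‖p.2‖ ^ 2) ^ m))
        ((volume.restrict (Set.Ioi 0)).prod volume) := by
    rw [integrable_prod_iff]
    · constructor
      · refine (ae_restrict_iff' measurableSet_Ioi).2 (Filter.Eventually.of_forall fun t ht => ?_)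
        have ht' : (0 : ℝ) < 1 + t := by have : (0 : ℝ) < t := ht; linarith
        exact (aux_slice d m q hq _ ht').1.const_mul (g t)
      · refine IntegrableOn.congr_fun (hgi.const_mul (sphereArea (d + 1) * Iint m d)) ?_
          measurableSet_Ioi
        intro t ht
        have ht0 : (0 : ℝ) < t := ht
        have ht' : (0 : ℝ) < 1 + t := by linarith
        have hn : ∀ x : EuclideanSpace ℝ (Fin (d + 1)),
            ‖g t * (1 / ((1 + t) ^ 2 + ‖x‖ ^ 2) ^ m)‖
              = g t * (1 / ((1 + t) ^ 2 + ‖x‖ ^ 2) ^ m) := fun x =>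
          Real.norm_of_nonneg (mul_nonneg (hg0 t ht0) (by positivity))
        simp only [hn]
        rw [integral_const_mul, (aux_slice d m q hq _ ht').2]
        ring
    · apply Measurable.aestronglyMeasurable
      have := hgc.measurable
      fun_prop
  refine ⟨hI, ?_⟩
  rw [integral_prod _ hI, ← integral_const_mul]
  refine setIntegral_congr_fun measurableSet_Ioi ?_
  intro t ht
  have ht' : (0 : ℝ) < 1 + t := by have : (0 : ℝ) < t := ht; linarith
  simp only
  rw [integral_const_mul, (aux_slice d m q hq _ ht').2]
  ring

/-- splitting off the last coordinate -/
def splitLast (d : ℕ) : EuclideanSpace ℝ (Fin (d + 1)) ≃ᵐ ℝ × EuclideanSpace ℝ (Fin d) :=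
  ((MeasurableEquiv.toLp 2 (Fin (d + 1) → ℝ)).symm.trans
    (MeasurableEquiv.piFinSuccAbove (fun _ => ℝ) (Fin.last d))).trans
    (MeasurableEquiv.prodCongr (MeasurableEquiv.refl ℝ) (MeasurableEquiv.toLp 2 (Fin d → ℝ)))

lemma splitLast_mp (d : ℕ) : MeasurePreserving (splitLast d) := by
  have h1 := EuclideanSpace.volume_preserving_symm_measurableEquiv_toLp (Fin (d + 1))
  have h2 := volume_preserving_piFinSuccAbove (fun _ : Fin (d + 1) => ℝ) (Fin.last d)
  have h3 := (MeasurePreserving.id (volume : Measure ℝ)).prod (PiLp.volume_preserving_toLp (Fin d))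
  exact h3.comp (h2.comp h1)

lemma splitLast_fst (d : ℕ) (y : EuclideanSpace ℝ (Fin (d + 1))) :
    (splitLast d y).1 = y (Fin.last d) := rfl

lemma splitLast_snd (d : ℕ) (y : EuclideanSpace ℝ (Fin (d + 1))) (i : Fin d) :
    (splitLast d y).2 i = y i.castSucc := by
  change y ((Fin.last d).succAbove i) = _
  simp

lemma lastCoord_eq (d : ℕ) [NeZero (d + 1)] (y : EuclideanSpace ℝ (Fin (d + 1))) :
    lastCoord (d + 1) y = (splitLast d y).1 := rfl

lemma barNormSq_eq (d : ℕ) [NeZero (d + 1)] (y : EuclideanSpace ℝ (Fin (d + 1))) :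
    barNormSq (d + 1) y = ‖(splitLast d y).2‖ ^ 2 := by
  rw [EuclideanSpace.real_norm_sq_eq, barNormSq, Fin.sum_univ_castSucc]
  simp [splitLast_snd]

lemma normSq_eq (d : ℕ) (y : EuclideanSpace ℝ (Fin (d + 1))) :
    ‖y‖ ^ 2 = (splitLast d y).1 ^ 2 + ‖(splitLast d y).2‖ ^ 2 := by
  rw [EuclideanSpace.real_norm_sq_eq, EuclideanSpace.real_norm_sq_eq, Fin.sum_univ_castSucc]
  simp [splitLast_snd, splitLast_fst, add_comm]

lemma aux_main (e : ℕ) [NeZero (e + 7)] :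
    ∫ y in halfSpace (e + 7), L3 (e + 7) y * (lastCoord (e + 7) y) ^ 2
      = sphereArea (e + 6) * (32 / (((e : ℝ) + 4) * (e + 3) * (e + 2) * (e + 1)))
          * Iint (e + 7) (e + 7) := by
  set G : ℝ × EuclideanSpace ℝ (Fin (e + 6)) → ℝ := fun p =>
    (p.1 ^ 2 + ‖p.2‖ ^ 2 - 1) / ((1 + p.1) ^ 2 + ‖p.2‖ ^ 2) ^ (e + 6) * p.1 ^ 2 with hG
  have step1 : ∫ y in halfSpace (e + 7), L3 (e + 7) y * (lastCoord (e + 7) y) ^ 2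
      = ∫ p in (Set.Ici (0 : ℝ)) ×ˢ (Set.univ : Set (EuclideanSpace ℝ (Fin (e + 6)))), G p := by
    rw [← (splitLast_mp (e + 6)).setIntegral_preimage_emb (splitLast (e + 6)).measurableEmbedding]
    have hs : halfSpace (e + 7) = (splitLast (e + 6)) ⁻¹'
        ((Set.Ici (0 : ℝ)) ×ˢ (Set.univ : Set (EuclideanSpace ℝ (Fin (e + 6))))) := by
      ext y
      simp [halfSpace, lastCoord_eq]
    rw [hs]
    congr 1
    ext y
    simp only [hG, L3]
    rw [lastCoord_eq (e + 6), barNormSq_eq (e + 6), normSq_eq (e + 6)]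
    rfl
  have hmeas : (volume : Measure (ℝ × EuclideanSpace ℝ (Fin (e + 6)))).restrict
      ((Set.Ici (0 : ℝ)) ×ˢ (Set.univ : Set (EuclideanSpace ℝ (Fin (e + 6)))))
      = (volume.restrict (Set.Ioi (0 : ℝ))).prod volume := by
    rw [Measure.volume_eq_prod, ← Measure.prod_restrict, Measure.restrict_univ,
      restrict_Ioi_eq_restrict_Ici]
  obtain ⟨ti1, tv1⟩ := aux_t e
  obtain ⟨ti2, tv2⟩ := aux_t (e + 1)
  have eq2 : Set.EqOn (fun t : ℝ => t ^ 2 / (1 + t) ^ (e + 1 + 4))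
      (fun t : ℝ => (t ^ 2 * (1 + t)) * (1 / (1 + t) ^ (e + 5 + 1))) (Set.Ioi 0) := by
    intro t ht
    have ht' : (0 : ℝ) < 1 + t := by have : (0 : ℝ) < t := ht; linarith
    simp only
    field_simp
    ring
  have eq1 : Set.EqOn (fun t : ℝ => t ^ 2 / (1 + t) ^ (e + 4))
      (fun t : ℝ => (t ^ 2) * (1 / (1 + t) ^ (e + 3 + 1))) (Set.Ioi 0) := by
    intro t ht
    simp only
    ring
  obtain ⟨p1, w1⟩ := aux_prod (e + 5) (e + 5) (e + 3) (by omega) (fun t => t ^ 2) (by fun_prop)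
    (fun t ht => by positivity) (ti1.congr_fun eq1 measurableSet_Ioi)
  obtain ⟨p2, w2⟩ := aux_prod (e + 5) (e + 6) (e + 5) (by omega) (fun t => t ^ 2 * (1 + t))
    (by fun_prop) (fun t ht => by positivity) (ti2.congr_fun eq2 measurableSet_Ioi)
  rw [← setIntegral_congr_fun measurableSet_Ioi eq1, tv1] at w1
  rw [← setIntegral_congr_fun measurableSet_Ioi eq2, tv2] at w2
  rw [step1, hmeas]
  have hGeq : ∀ᵐ p ∂((volume.restrict (Set.Ioi (0 : ℝ))).prod
      (volume : Measure (EuclideanSpace ℝ (Fin (e + 6))))), G p =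
      p.1 ^ 2 * (1 / ((1 + p.1) ^ 2 + ‖p.2‖ ^ 2) ^ (e + 5))
      - 2 * (p.1 ^ 2 * (1 + p.1) * (1 / ((1 + p.1) ^ 2 + ‖p.2‖ ^ 2) ^ (e + 6))) := by
    rw [← hmeas]
    refine (ae_restrict_iff' (measurableSet_Ici.prod MeasurableSet.univ)).2
      (Filter.Eventually.of_forall fun p hp => ?_)
    have h0 : (0 : ℝ) ≤ p.1 := hp.1
    have hD : 0 < (1 + p.1) ^ 2 + ‖p.2‖ ^ 2 := by positivity
    simp only [hG]
    field_simp
    ring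
  rw [integral_congr_ae hGeq, integral_sub p1 (p2.const_mul 2), integral_const_mul, w1, w2]
  have r1 := aux_rec (e + 5) (e + 5) (by omega)
  have r2 := aux_rec (e + 5) (e + 4) (by omega)
  have r3 := aux_split (e + 5) (e + 5) (by omega)
  change _ = _ * Iint (e + 7) (e + 7) at r1
  change _ * Iint (e + 6) (e + 5) = _ at r1
  change _ * Iint (e + 5) (e + 5) = _ * Iint (e + 6) (e + 7) at r2
  change Iint (e + 6) (e + 7) = Iint (e + 5) (e + 5) - Iint (e + 6) (e + 5) at r3
  rw [r3] at r2
  push_cast at r1 r2 ⊢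
  have he : (0 : ℝ) ≤ e := Nat.cast_nonneg e
  have s1 : Iint (e + 6) (e + 5) = 2 * Iint (e + 7) (e + 7) := by
    have h6 : (e : ℝ) + 6 ≠ 0 := by positivity
    apply mul_left_cancel₀ h6
    linear_combination r1
  have s2 : Iint (e + 5) (e + 5) = 4 * ((e : ℝ) + 5) / (e + 4) * Iint (e + 7) (e + 7) := by
    have h4 : (e : ℝ) + 4 ≠ 0 := by positivity
    field_simp
    rw [s1] at r2
    linear_combination -r2
  rw [s1, s2]
  field_simp
  ring

/-- `∫_{ℝⁿ₊} L₃ yₙ² dy = ω_{n-2} · 32/((n-3)(n-4)(n-5)(n-6)) · Iₙⁿ`. -/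
theorem statement15 (n : ℕ) [NeZero n] (hn : 7 ≤ n) :
    ∫ y in halfSpace n, L3 n y * (lastCoord n y) ^ 2
      = sphereArea (n - 1)
          * (32 / (((n : ℝ) - 3) * ((n : ℝ) - 4) * ((n : ℝ) - 5) * ((n : ℝ) - 6)))
          * Iint n n := by
  obtain ⟨e, rfl⟩ : ∃ e, n = e + 7 := ⟨n - 7, by omega⟩
  rw [aux_main e]
  push_cast
  congr 3
  ring
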